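/- There do not exist integers 0 < p₁ < p₂ < p₃ < p₄ such that every three-element subtriple (p_i, p_j, p_k) with i < j < k is pairwise coprime and satisfies gcd(p_i−p_j, p_i−p_k) = gcd(p_i−p_j, p_i+p_k) = gcd(p_i+p_j, p_i−p_k) = gcd(p_i+p_j, p_i+p_k) = 1. -/

import Mathlib

/-- A triple of integers is admissible if it is pairwise coprime and satisfies
`gcd(a ∓ b, a ∓ c) = 1` for all four sign choices. -/
def AdmissibleTriple (a b c : ℤ) : Prop :=
  Int.gcd a b = 1 ∧ Int.gcd a c = 1 ∧ Int.gcd b c = 1 ∧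
  Int.gcd (a - b) (a - c) = 1 ∧ Int.gcd (a - b) (a + c) = 1 ∧
  Int.gcd (a + b) (a - c) = 1 ∧ Int.gcd (a + b) (a + c) = 1

theorem gcd_one_parity {x y : ℤ} (h : Int.gcd x y = 1) : ¬ (x % 2 = 0 ∧ y % 2 = 0) := by
  rintro ⟨hx, hy⟩
  have h2 : (2 : ℤ) ∣ (Int.gcd x y : ℤ) :=
    Int.dvd_coe_gcd (Int.dvd_of_emod_eq_zero hx) (Int.dvd_of_emod_eq_zero hy)
  rw [h] at h2
  norm_num at h2

/-- The parity claim of Section 4 of the paper: there is no quadruple of integers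
`0 < p₁ < p₂ < p₃ < p₄` all of whose triples are admissible. -/
theorem no_quadruple_with_all_triples_admissible :
    ¬ ∃ p₁ p₂ p₃ p₄ : ℤ, 0 < p₁ ∧ p₁ < p₂ ∧ p₂ < p₃ ∧ p₃ < p₄ ∧
      AdmissibleTriple p₁ p₂ p₃ ∧ AdmissibleTriple p₁ p₂ p₄ ∧
      AdmissibleTriple p₁ p₃ p₄ ∧ AdmissibleTriple p₂ p₃ p₄ := by
  rintro ⟨a, b, c, d, -, -, -, -, h1, h2, h3, h4⟩
  obtain ⟨ab, ac, bc, h1, -⟩ := h1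
  obtain ⟨-, ad, bd, h2, -⟩ := h2
  obtain ⟨-, -, cd, h3, -⟩ := h3
  obtain ⟨-, -, -, h4, -⟩ := h4
  have ab := gcd_one_parity ab
  have ac := gcd_one_parity ac
  have bc := gcd_one_parity bc
  have ad := gcd_one_parity ad
  have bd := gcd_one_parity bd
  have cd := gcd_one_parity cd
  have h1 := gcd_one_parity h1
  have h2 := gcd_one_parity h2
  have h3 := gcd_one_parity h3
  have h4 := gcd_one_parity h4
  omega
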